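/- Let Γ be a distance-regular graph having classical parameters (d, q, α, β) with d ≥ 3 and q ∈ ℤ, |q| ≥ 2. Then q^{−i} ∈ π(Γ) for every i = 0, 1, 2, …; that is, the matrix K_{q^{−i}} = ((q^{−i})^{∂(x,y)})_{x,y∈X} is positive semidefinite for every non-negative integer i. -/

import Mathlib

open Matrix Filter

/-- A (bundled) distance-regular graph: a finite connected simple graph of diameter `d`
with intersection numbers `a i`, `b i`, `c i` for `0 ≤ i ≤ d`; `b 0` is the valency `k`. -/
structure DRG where
  X : Type
  fin : Fintype X
  G : SimpleGraph X
  d : ℕ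
  a : ℕ → ℕ
  b : ℕ → ℕ
  c : ℕ → ℕ
  conn : G.Connected
  dist_le : ∀ x y : X, G.dist x y ≤ d
  dist_eq : ∃ x y : X, G.dist x y = d
  bd : b d = 0
  c0 : c 0 = 0
  count_c : ∀ i ≤ d, ∀ x y : X, G.dist x y = i →
      {z : X | G.Adj y z ∧ G.dist x z = i - 1}.ncard = c i
  count_a : ∀ i ≤ d, ∀ x y : X, G.dist x y = i →
      {z : X | G.Adj y z ∧ G.dist x z = i}.ncard = a i
  count_b : ∀ i ≤ d, ∀ x y : X, G.dist x y = i →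
      {z : X | G.Adj y z ∧ G.dist x z = i + 1}.ncard = b i

attribute [instance] DRG.fin

noncomputable instance (Γ : DRG) : DecidableEq Γ.X := Classical.decEq _

noncomputable instance (Γ : DRG) : DecidableRel Γ.G.Adj := fun _ _ => Classical.dec _

namespace DRG

variable (Γ : DRG)

/-- The `i`-th distance matrix (over `ℂ`). -/
noncomputable def Amat (i : ℕ) : Matrix Γ.X Γ.X ℂ :=
  Matrix.of fun x y => if Γ.G.dist x y = i then 1 else 0

/-- The adjacency algebra `A(Γ) = span_ℂ {A_0, …, A_d}`. -/
noncomputable def adjAlg : Submodule ℂ (Matrix Γ.X Γ.X ℂ) :=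
  Submodule.span ℂ {M | ∃ i ≤ Γ.d, M = Γ.Amat i}

/-- The matrix `K_t = (t^{∂(x,y)})_{x,y}` (over `ℝ`). -/
noncomputable def Kmat (t : ℝ) : Matrix Γ.X Γ.X ℝ :=
  Matrix.of fun x y => t ^ Γ.G.dist x y

/-- `t ∈ π(Γ)`, i.e. `K_t` is positive semidefinite. -/
def piMem (t : ℝ) : Prop := (Γ.Kmat t).PosSemidef

/-- The Gibbs functional `φ_t(B) = ∑_x t^{∂(x,o)} B_{x,o}` with base vertex `o`. -/
noncomputable def gibbs (t : ℝ) (o : Γ.X) (B : Matrix Γ.X Γ.X ℂ) : ℂ :=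
  ∑ x : Γ.X, (t : ℂ) ^ Γ.G.dist x o * B x o

end DRG

/-- The Gaussian binomial `[i]_q = 1 + q + ⋯ + q^{i-1}`. -/
noncomputable def gaussOne (q : ℝ) (i : ℕ) : ℝ := ∑ h ∈ Finset.range i, q ^ h

/-- `Γ` has classical parameters `(d, q, α, β)`. -/
def DRG.HasClassical (Γ : DRG) (q α β : ℝ) : Prop :=
  (∀ i ≤ Γ.d, (Γ.b i : ℝ) = (gaussOne q Γ.d - gaussOne q i) * (β - α * gaussOne q i)) ∧
  (∀ i ≤ Γ.d, (Γ.c i : ℝ) = gaussOne q i * (1 + α * gaussOne q (i - 1)))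

namespace DRG

variable (Γ : DRG)

/-- The real matrix whose `(x, y)` entry is `f (∂(x, y))`. -/
noncomputable def distMat (f : ℕ → ℝ) : Matrix Γ.X Γ.X ℝ :=
  Matrix.of fun x y => f (Γ.G.dist x y)

/-- The action of the adjacency matrix on functions of the distance. -/
noncomputable def step (f : ℕ → ℝ) (i : ℕ) : ℝ :=
  Γ.c i * f (i - 1) + Γ.a i * f i + Γ.b i * f (i + 1)

/-- The indicator function of `{j}`. -/
noncomputable def ind (j i : ℕ) : ℝ := if i = j then 1 else 0

@[simp] lemma distMat_apply (f : ℕ → ℝ) (x y : Γ.X) : Γ.distMat f x y = f (Γ.G.dist x y) := rfl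

lemma natCast_ncard_eq_sum (p : Γ.X → Prop) [DecidablePred p] :
    (({z | p z} : Set Γ.X).ncard : ℝ) = ∑ z, if p z then (1 : ℝ) else 0 := by
  rw [Finset.sum_boole, Set.ncard_eq_toFinset_card', Set.toFinset_ofPred]

lemma dist_le_succ_of_adj {x y z : Γ.X} (h : Γ.G.Adj y z) :
    Γ.G.dist x z ≤ Γ.G.dist x y + 1 := by
  have h1 := Γ.conn.dist_triangle (u := x) (v := y) (w := z)
  rwa [SimpleGraph.dist_eq_one_iff_adj.2 h] at h1

lemma sum_ind_one_mul (f : ℕ → ℝ) (x y : Γ.X) :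
    ∑ z, ind 1 (Γ.G.dist y z) * f (Γ.G.dist x z) = Γ.step f (Γ.G.dist x y) := by
  classical
  have hi : Γ.G.dist x y ≤ Γ.d := Γ.dist_le x y
  unfold step
  rw [← Γ.count_c _ hi x y rfl, ← Γ.count_a _ hi x y rfl, ← Γ.count_b _ hi x y rfl]
  simp only [natCast_ncard_eq_sum, Finset.sum_mul, ← Finset.sum_add_distrib]
  refine Finset.sum_congr rfl fun z _ => ?_
  simp only [ind, SimpleGraph.dist_eq_one_iff_adj]
  by_cases h : Γ.G.Adj y z
  · have h1 := Γ.dist_le_succ_of_adj (x := x) h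
    have h2 := Γ.dist_le_succ_of_adj (x := x) h.symm
    rcases Nat.eq_zero_or_pos (Γ.G.dist x y) with h0 | h0
    · have hxy : x = y := Γ.conn.dist_eq_zero_iff.1 h0
      subst hxy
      simp [h, SimpleGraph.dist_eq_one_iff_adj.2 h]
    · obtain h3 | h3 | h3 : Γ.G.dist x z = Γ.G.dist x y - 1 ∨ Γ.G.dist x z = Γ.G.dist x y ∨
          Γ.G.dist x z = Γ.G.dist x y + 1 := by omega
      · have e1 : Γ.G.dist x y - 1 ≠ Γ.G.dist x y := by omega
        have e2 : Γ.G.dist x y - 1 ≠ Γ.G.dist x y + 1 := by omega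
        simp [h, h3, e1, e2]
      · have e1 : Γ.G.dist x y ≠ Γ.G.dist x y - 1 := by omega
        simp [h, h3, e1]
      · have e1 : Γ.G.dist x y + 1 ≠ Γ.G.dist x y - 1 := by omega
        simp [h, h3, e1]
  · simp [h]

lemma distMat_isSymm (f : ℕ → ℝ) : (Γ.distMat f).IsSymm := by
  ext x y
  simp [SimpleGraph.dist_comm]

lemma adj_mul_distMat (f : ℕ → ℝ) :
    Γ.distMat (ind 1) * Γ.distMat f = Γ.distMat (Γ.step f) := by
  ext y x
  simp only [Matrix.mul_apply, distMat_apply]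
  rw [Γ.G.dist_comm (u := y), ← Γ.sum_ind_one_mul f x y]
  refine Finset.sum_congr rfl fun z _ => ?_
  rw [Γ.G.dist_comm (u := x)]

lemma distMat_congr {f g : ℕ → ℝ} (h : ∀ i ≤ Γ.d, f i = g i) : Γ.distMat f = Γ.distMat g := by
  ext x y
  exact h _ (Γ.dist_le x y)

lemma distMat_ind_zero : Γ.distMat (ind 0) = 1 := by
  ext x y
  by_cases h : x = y
  · subst h
    simp [ind]
  · simp [ind, h, Γ.conn.dist_eq_zero_iff]

lemma exists_adj_dist {x y : Γ.X} {i : ℕ} (h : Γ.G.dist x y = i + 1) :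
    ∃ z, Γ.G.Adj y z ∧ Γ.G.dist x z = i := by
  obtain ⟨p, hp⟩ := Γ.conn.exists_walk_length_eq_dist y x
  rw [SimpleGraph.dist_comm, h] at hp
  cases p with
  | nil => simp at hp
  | @cons _ z _ hyz p =>
    refine ⟨z, hyz, ?_⟩
    have h1 : p.length = i := by simpa using hp
    have h2 := SimpleGraph.dist_le p
    have h3 := Γ.dist_le_succ_of_adj (x := x) hyz.symm
    rw [SimpleGraph.dist_comm] at h2
    omega

lemma exists_dist_eq {i : ℕ} (hi : i ≤ Γ.d) : ∃ x y, Γ.G.dist x y = i := by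
  obtain ⟨x, y, h⟩ := Γ.dist_eq
  induction hi using Nat.decreasingInduction with
  | self => exact ⟨x, y, h⟩
  | of_succ j hj ih =>
    obtain ⟨x, y, h⟩ := ih
    obtain ⟨z, -, hz⟩ := Γ.exists_adj_dist h
    exact ⟨x, z, hz⟩

lemma c_pos {x y : Γ.X} {i : ℕ} (h : Γ.G.dist x y = i + 1) : 0 < Γ.c (i + 1) := by
  obtain ⟨z, hz, hz'⟩ := Γ.exists_adj_dist h
  rw [← Γ.count_c _ (h ▸ Γ.dist_le x y) x y h, Set.ncard_pos]
  exact ⟨z, hz, by simpa using hz'⟩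

lemma b_pos {i : ℕ} (hi : i < Γ.d) : 0 < Γ.b i := by
  obtain ⟨x, y, h⟩ := Γ.exists_dist_eq hi
  obtain ⟨z, hz, hz'⟩ := Γ.exists_adj_dist h
  rw [← Γ.count_b _ hi.le x z hz', Set.ncard_pos]
  exact ⟨y, hz.symm, h⟩

lemma a_zero : Γ.a 0 = 0 := by
  obtain ⟨x⟩ := Γ.conn.nonempty
  rw [← Γ.count_a 0 (Nat.zero_le _) x x (by simp), Set.ncard_eq_zero]
  ext z
  simp only [Set.mem_ofPred_eq, Set.mem_empty_iff_false, iff_false, not_and]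
  intro h h0
  exact h.ne (Γ.conn.dist_eq_zero_iff.1 h0)

lemma c_add_a_add_b {i : ℕ} (hi : i ≤ Γ.d) : (Γ.c i + Γ.a i + Γ.b i : ℝ) = Γ.b 0 := by
  obtain ⟨x, y, h⟩ := Γ.exists_dist_eq hi
  have h1 := Γ.sum_ind_one_mul (fun _ => 1) x y
  have h2 := Γ.sum_ind_one_mul (fun _ => 1) y y
  rw [h1] at h2
  simpa [step, h, Γ.a_zero, Γ.c0] using h2

lemma step_ind_succ (i j : ℕ) : Γ.step (ind (i + 1)) j =
    Γ.c (i + 2) * ind (i + 2) j + Γ.a (i + 1) * ind (i + 1) j + Γ.b i * ind i j := by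
  unfold step ind
  obtain h | h | h | h : j = i ∨ j = i + 1 ∨ j = i + 2 ∨ (j ≠ i ∧ j ≠ i + 1 ∧ j ≠ i + 2) := by
    omega
  · subst h
    have : j - 1 ≠ j + 1 := by omega
    simp [this]
  · subst h
    simp
  · subst h
    simp
  · have : j - 1 ≠ i + 1 := by omega
    simp [h, this]

/-- Multiplication by a distance matrix acts as a scalar on an eigenmatrix of the adjacency
matrix. -/
lemma exists_distMat_ind_mul {M : Matrix Γ.X Γ.X ℝ} {θ : ℝ}
    (hM : Γ.distMat (ind 1) * M = θ • M) (i : ℕ) :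
    ∃ v : ℝ, Γ.distMat (ind i) * M = v • M := by
  induction i using Nat.twoStepInduction with
  | zero => exact ⟨1, by rw [distMat_ind_zero, one_mul, one_smul]⟩
  | one => exact ⟨θ, hM⟩
  | more i h0 h1 =>
    obtain ⟨v0, h0⟩ := h0
    obtain ⟨v1, h1⟩ := h1
    by_cases hx : ∃ x y, Γ.G.dist x y = i + 2
    · obtain ⟨x, y, hx⟩ := hx
      have hc : (Γ.c (i + 2) : ℝ) ≠ 0 := by
        have := Γ.c_pos hx
        positivity
      have h2 : Γ.distMat (Γ.step (ind (i + 1))) = (Γ.c (i + 2) : ℝ) • Γ.distMat (ind (i + 2)) +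
          (Γ.a (i + 1) : ℝ) • Γ.distMat (ind (i + 1)) + (Γ.b i : ℝ) • Γ.distMat (ind i) := by
        ext x y
        simp [step_ind_succ]
      have h3 : (Γ.c (i + 2) : ℝ) • (Γ.distMat (ind (i + 2)) * M) =
          (v1 * θ - Γ.a (i + 1) * v1 - Γ.b i * v0) • M := by
        have h4 := congrArg (· * M) h2
        simp only [add_mul, smul_mul_assoc, ← adj_mul_distMat, h0, h1, mul_assoc, mul_smul_comm,
          hM] at h4
        rw [smul_smul, smul_smul, smul_smul] at h4
        rw [sub_smul, sub_smul, h4]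
        abel
      refine ⟨(Γ.c (i + 2) : ℝ)⁻¹ * (v1 * θ - Γ.a (i + 1) * v1 - Γ.b i * v0), ?_⟩
      rw [mul_smul, ← h3, inv_smul_smul₀ hc]
    · push Not at hx
      refine ⟨0, ?_⟩
      have : Γ.distMat (ind (i + 2)) = 0 := by
        ext x y
        simp [ind, hx x y]
      rw [this, zero_mul, zero_smul]

lemma exists_distMat_mul {M : Matrix Γ.X Γ.X ℝ} {θ : ℝ}
    (hM : Γ.distMat (ind 1) * M = θ • M) (f : ℕ → ℝ) :
    ∃ v : ℝ, Γ.distMat f * M = v • M := by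
  choose v hv using Γ.exists_distMat_ind_mul hM
  refine ⟨∑ i ∈ Finset.range (Γ.d + 1), f i * v i, ?_⟩
  have : Γ.distMat f = ∑ i ∈ Finset.range (Γ.d + 1), f i • Γ.distMat (ind i) := by
    ext x y
    have := Γ.dist_le x y
    simp [Matrix.sum_apply, ind, this]
  rw [this, Finset.sum_mul, Finset.sum_smul]
  refine Finset.sum_congr rfl fun i _ => ?_
  rw [smul_mul_assoc, hv, smul_smul]

end DRG

namespace Matrix

variable {X : Type*} [Fintype X]

lemma posSemidef_of_mul_self_eq_smul {M : Matrix X X ℝ} (hM : M.IsSymm) {c : ℝ} (hc : 0 < c)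
    (h : M * M = c • M) : M.PosSemidef := by
  have h1 : M = c⁻¹ • (M * Mᴴ) := by
    rw [conjTranspose_eq_transpose_of_trivial, hM.eq, h, inv_smul_smul₀ hc.ne']
  rw [h1]
  exact (posSemidef_self_mul_conjTranspose M).smul (inv_nonneg.2 hc.le)

/-- If `M` is a multiple of a symmetric projection and `R` maps the Hadamard square of `M` to a
multiple of the all-ones matrix, then `R` maps the Hadamard product of any two columns of `M` to a
constant vector. -/
lemma sum_mul_mul_eq_const [Nonempty X] {M R : Matrix X X ℝ} {c m ω p : ℝ} (hM : M.IsSymm)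
    (hMM : M * M = c • M) (hdiag : ∀ x, M x x = m) (hR : ∀ w, ∑ v, R w v = p)
    (hRM : ∀ w x, ∑ v, R w v * (M v x * M v x) = ω) (x y w : X) :
    ∑ v, R w v * (M x v * M y v) = p * c / Fintype.card X * M x y := by
  classical
  set n : ℝ := (Fintype.card X : ℝ) with hn
  have hn0 : n ≠ 0 := by simp [hn]
  set D : Matrix X X ℝ := diagonal (R w) with hD
  set δ : ℝ := p * c / n with hδ
  have hG : ∀ x y, (M * D * M) x y = ∑ v, R w v * (M x v * M y v) := fun x y => by
    simp only [hD, mul_apply (M := M * diagonal (R w)), mul_diagonal]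
    refine Finset.sum_congr rfl fun v _ => ?_
    rw [hM.apply v y]
    ring
  have hsq : ∀ x, ∑ v, M x v * M x v = c * m := fun x => by
    have h1 := congrFun (congrFun hMM x) x
    rw [mul_apply, smul_apply, hdiag, smul_eq_mul] at h1
    rw [← h1]
    refine Finset.sum_congr rfl fun v _ => ?_
    rw [hM.apply v x]
  have hω : n * ω = p * (c * m) := by
    calc n * ω = ∑ x, ∑ v, R w v * (M v x * M v x) := by simp [hRM, hn]
      _ = ∑ v, R w v * ∑ x, M v x * M v x := by
        rw [Finset.sum_comm]
        simp only [Finset.mul_sum]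
      _ = p * (c * m) := by simp only [hsq, ← Finset.sum_mul, hR]
  have htrM : trace M = n * m := by simp [trace, hdiag, hn]
  have htrDM : trace (D * M) = p * m := by
    simp [trace, hD, diagonal_mul, hdiag, ← Finset.sum_mul, hR]
  have htrDMDM : trace (D * M * (D * M)) = p * ω := by
    simp only [trace, diag_apply, hD, mul_apply (M := diagonal (R w) * M), diagonal_mul]
    rw [Finset.sum_comm]
    rw [← hR w, Finset.sum_mul]
    refine Finset.sum_congr rfl fun v _ => ?_
    rw [← hRM w v, Finset.mul_sum]
    refine Finset.sum_congr rfl fun u _ => ?_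
    rw [hM.apply u v]
    ring
  have htr1 : trace (M * M) = c * (n * m) := by rw [hMM, trace_smul, htrM, smul_eq_mul]
  have htr2 : trace (M * D * M * M) = c * (c * (p * m)) := by
    rw [mul_assoc (M * D), hMM, mul_smul_comm, trace_smul, mul_assoc, trace_mul_comm, mul_assoc,
      hMM, mul_smul_comm, trace_smul, htrDM, smul_eq_mul, smul_eq_mul]
  have htr3 : trace (M * D * M * (M * D * M)) = c * (c * (p * ω)) := by
    have h1 : M * D * M * (M * D * M) = c • (M * (D * M * (D * M))) := by
      calc M * D * M * (M * D * M) = M * D * (M * M) * (D * M) := by simp only [mul_assoc]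
        _ = c • (M * (D * M * (D * M))) := by
          rw [hMM, mul_smul_comm, smul_mul_assoc]
          simp only [mul_assoc]
    have h2 : D * M * (D * M) * M = c • (D * M * (D * M)) := by
      calc D * M * (D * M) * M = D * M * (D * (M * M)) := by simp only [mul_assoc]
        _ = _ := by rw [hMM, mul_smul_comm, mul_smul_comm]
    rw [h1, trace_smul, trace_mul_comm, h2, trace_smul, htrDMDM, smul_eq_mul, smul_eq_mul]
  set E : Matrix X X ℝ := M * D * M - δ • M with hE
  have hEsymm : E.IsSymm := by
    rw [hE, IsSymm, transpose_sub, transpose_smul, transpose_mul, transpose_mul, hM.eq, hD,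
      diagonal_transpose, mul_assoc]
  have htrE : trace (E * E) = 0 := by
    have h1 : trace (E * E) = c * (c * (p * ω)) - 2 * δ * (c * (c * (p * m))) +
        δ * δ * (c * (n * m)) := by
      rw [hE]
      simp only [sub_mul, mul_sub, smul_mul_assoc, mul_smul_comm, trace_sub, trace_smul,
        smul_eq_mul, htr1, htr2, htr3]
      rw [trace_mul_comm M (M * D * M), htr2]
      ring
    have h2 : ω = p * (c * m) / n := by
      rw [eq_div_iff hn0]
      linarith
    rw [h1, h2, hδ]
    field_simp
    ring
  have hE0 : E = 0 := by
    have h1 : trace (E * Eᴴ) = 0 := by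
      rwa [conjTranspose_eq_transpose_of_trivial, hEsymm.eq]
    exact trace_mul_conjTranspose_self_eq_zero_iff.1 h1
  have h3 := congrFun (congrFun hE0 x) y
  rw [hE, sub_apply, smul_apply, zero_apply, hG, smul_eq_mul] at h3
  linarith

end Matrix

namespace DRG

variable {Γ : DRG} {q α β : ℝ}

lemma gaussOne_eq (hq : q ≠ 1) (i : ℕ) : gaussOne q i = (q ^ i - 1) / (q - 1) :=
  geom_sum_eq hq i

lemma gaussOne_pred (hq0 : q ≠ 0) {i : ℕ} (hi : i ≠ 0) :
    gaussOne q (i - 1) = (gaussOne q i - 1) / q := by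
  obtain ⟨j, rfl⟩ := Nat.exists_eq_succ_of_ne_zero hi
  have h : gaussOne q (j + 1) = q * gaussOne q j + 1 := geom_sum_succ
  rw [Nat.succ_eq_add_one, h, Nat.add_sub_cancel]
  field_simp
  ring

namespace HasClassical

variable (h : Γ.HasClassical q α β)
include h

lemma b_eq {i : ℕ} (hi : i ≤ Γ.d) :
    (Γ.b i : ℝ) = (gaussOne q Γ.d - gaussOne q i) * (β - α * gaussOne q i) :=
  h.1 i hi

lemma c_eq (hq0 : q ≠ 0) {i : ℕ} (hi : i ≤ Γ.d) :
    (Γ.c i : ℝ) = gaussOne q i * (1 + α * ((gaussOne q i - 1) / q)) := by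
  rw [h.2 i hi]
  rcases eq_or_ne i 0 with rfl | h0
  · simp [gaussOne]
  · rw [gaussOne_pred hq0 h0]

lemma b_zero : (Γ.b 0 : ℝ) = gaussOne q Γ.d * β := by
  rw [h.b_eq (Nat.zero_le _)]
  simp [gaussOne]

lemma b_one (hd : 3 ≤ Γ.d) : (Γ.b 1 : ℝ) = (gaussOne q Γ.d - 1) * (β - α) := by
  rw [h.b_eq (by omega)]
  simp [gaussOne]

lemma b_two (hd : 3 ≤ Γ.d) :
    (Γ.b 2 : ℝ) = (gaussOne q Γ.d - (1 + q)) * (β - α * (1 + q)) := by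
  rw [h.b_eq (by omega)]
  simp [gaussOne, Finset.sum_range_succ]

lemma c_one (hd : 3 ≤ Γ.d) : (Γ.c 1 : ℝ) = 1 := by
  rw [h.2 1 (by omega)]
  simp [gaussOne]

lemma c_two (hd : 3 ≤ Γ.d) : (Γ.c 2 : ℝ) = (1 + q) * (1 + α) := by
  rw [h.2 2 (by omega)]
  simp [gaussOne, Finset.sum_range_succ]

lemma a_one (hd : 3 ≤ Γ.d) : (Γ.a 1 : ℝ) = Γ.b 0 - Γ.b 1 - 1 := by
  have h1 := Γ.c_add_a_add_b (i := 1) (by omega)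
  rw [h.c_one hd] at h1
  linarith

lemma step_inv_pow (hq0 : q ≠ 0) (hq1 : q ≠ 1) (hd : 3 ≤ Γ.d) {i : ℕ} (hi : i ≤ Γ.d) :
    Γ.step (fun j => q⁻¹ ^ j) i = (Γ.b 1 / q - 1) * q⁻¹ ^ i + (1 + (Γ.a 1 + 1) / q) := by
  have hc : (Γ.c i : ℝ) * q⁻¹ ^ (i - 1) = Γ.c i * (q * q⁻¹ ^ i) := by
    rcases eq_or_ne i 0 with rfl | h0
    · simp [Γ.c0]
    · obtain ⟨j, rfl⟩ := Nat.exists_eq_succ_of_ne_zero h0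
      rw [Nat.succ_eq_add_one, Nat.add_sub_cancel, pow_succ]
      field_simp
  have ha : (Γ.a i : ℝ) = Γ.b 0 - Γ.b i - Γ.c i := by linarith [Γ.c_add_a_add_b hi]
  have hu : q ^ i ≠ 0 := pow_ne_zero _ hq0
  have hq1' : q - 1 ≠ 0 := sub_ne_zero.2 hq1
  simp only [step]
  rw [hc, ha, h.a_one hd, h.b_one hd, h.b_zero, h.b_eq hi, h.c_eq hq0 hi, gaussOne_eq hq1 i,
    pow_succ, inv_pow]
  generalize q ^ i = u at *
  generalize gaussOne q Γ.d = D
  field_simp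
  ring

lemma step_inv_sq_pow (hq0 : q ≠ 0) (hq1 : q ≠ 1) (hd : 3 ≤ Γ.d) {i : ℕ} (hi : i ≤ Γ.d) :
    Γ.step (fun j => q⁻¹ ^ j * q⁻¹ ^ j) i =
      (Γ.b 2 / q ^ 2 - (1 + q)) * (q⁻¹ ^ i * q⁻¹ ^ i) +
      ((q + 1) / q ^ 2 * (q + β + α * (gaussOne q Γ.d - 1) + (q - α) * (q - 1) - 2 * α)) *
        q⁻¹ ^ i + (q + 1) / q ^ 2 * α := by
  have hc : (Γ.c i : ℝ) * (q⁻¹ ^ (i - 1) * q⁻¹ ^ (i - 1)) =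
      Γ.c i * ((q * q⁻¹ ^ i) * (q * q⁻¹ ^ i)) := by
    rcases eq_or_ne i 0 with rfl | h0
    · simp [Γ.c0]
    · obtain ⟨j, rfl⟩ := Nat.exists_eq_succ_of_ne_zero h0
      rw [Nat.succ_eq_add_one, Nat.add_sub_cancel, pow_succ]
      field_simp
  have ha : (Γ.a i : ℝ) = Γ.b 0 - Γ.b i - Γ.c i := by linarith [Γ.c_add_a_add_b hi]
  have hu : q ^ i ≠ 0 := pow_ne_zero _ hq0
  have hq1' : q - 1 ≠ 0 := sub_ne_zero.2 hq1
  simp only [step]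
  rw [hc, ha, h.b_two hd, h.b_zero, h.b_eq hi, h.c_eq hq0 hi, gaussOne_eq hq1 i,
    pow_succ, inv_pow]
  generalize q ^ i = u at *
  generalize gaussOne q Γ.d = D
  field_simp
  ring

end HasClassical

end DRG

namespace DRG

variable (Γ : DRG)

lemma step_one {i : ℕ} (hi : i ≤ Γ.d) : Γ.step (fun _ => 1) i = Γ.b 0 := by
  simpa [step] using Γ.c_add_a_add_b hi

lemma adj_mul_one : Γ.distMat (ind 1) * Γ.distMat (fun _ => 1) =
    (Γ.b 0 : ℝ) • Γ.distMat (fun _ => 1) := by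
  rw [adj_mul_distMat, Γ.distMat_congr (fun i hi => Γ.step_one hi)]
  ext x y
  simp

/-- The matrix `(A - θ₁)(A - θ₂)`, where `A` is the adjacency matrix. -/
noncomputable def quadMat (θ₁ θ₂ : ℝ) : Matrix Γ.X Γ.X ℝ :=
  Γ.distMat fun j => Γ.c 2 * ind 2 j + (Γ.a 1 - θ₁ - θ₂) * ind 1 j + (Γ.b 0 + θ₁ * θ₂) * ind 0 j

lemma quadMat_eq (θ₁ θ₂ : ℝ) : Γ.quadMat θ₁ θ₂ =
    Γ.distMat (ind 1) * Γ.distMat (ind 1) - (θ₁ + θ₂) • Γ.distMat (ind 1) + (θ₁ * θ₂) • 1 := by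
  rw [adj_mul_distMat, ← distMat_ind_zero]
  ext x y
  simp only [quadMat, distMat_apply, Matrix.add_apply, Matrix.sub_apply, Matrix.smul_apply,
    smul_eq_mul, Γ.step_ind_succ 0]
  ring

lemma quadMat_mul (θ₁ θ₂ : ℝ) (F : Matrix Γ.X Γ.X ℝ) : Γ.quadMat θ₁ θ₂ * F =
    Γ.distMat (ind 1) * (Γ.distMat (ind 1) * F) - (θ₁ + θ₂) • (Γ.distMat (ind 1) * F) +
      (θ₁ * θ₂) • F := by
  rw [quadMat_eq, add_mul, sub_mul, smul_mul_assoc, smul_mul_assoc, one_mul, mul_assoc]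

namespace HasClassical

variable {Γ} {q α β : ℝ} (h : Γ.HasClassical q α β)
include h

lemma adj_mul_inv_pow (hq0 : q ≠ 0) (hq1 : q ≠ 1) (hd : 3 ≤ Γ.d) :
    Γ.distMat (ind 1) * Γ.distMat (fun j => q⁻¹ ^ j) =
      (Γ.b 1 / q - 1) • Γ.distMat (fun j => q⁻¹ ^ j) +
        (1 + (Γ.a 1 + 1) / q) • Γ.distMat (fun _ => 1) := by
  rw [adj_mul_distMat, Γ.distMat_congr fun i hi => h.step_inv_pow hq0 hq1 hd hi]
  ext x y
  simp

lemma adj_mul_inv_sq_pow (hq0 : q ≠ 0) (hq1 : q ≠ 1) (hd : 3 ≤ Γ.d) :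
    ∃ κ l : ℝ, Γ.distMat (ind 1) * Γ.distMat (fun j => q⁻¹ ^ j * q⁻¹ ^ j) =
      (Γ.b 2 / q ^ 2 - (1 + q)) • Γ.distMat (fun j => q⁻¹ ^ j * q⁻¹ ^ j) +
        κ • Γ.distMat (fun j => q⁻¹ ^ j) + l • Γ.distMat (fun _ => 1) := by
  refine ⟨(q + 1) / q ^ 2 * (q + β + α * (gaussOne q Γ.d - 1) + (q - α) * (q - 1) - 2 * α),
    (q + 1) / q ^ 2 * α, ?_⟩
  rw [adj_mul_distMat, Γ.distMat_congr fun i hi => h.step_inv_sq_pow hq0 hq1 hd hi]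
  ext x y
  simp only [distMat_apply, Matrix.add_apply, Matrix.smul_apply, smul_eq_mul, mul_one]

lemma adj_mul_sub {μ : ℝ} (hq0 : q ≠ 0) (hq1 : q ≠ 1) (hd : 3 ≤ Γ.d)
    (hμ : μ * (Γ.b 0 - (Γ.b 1 / q - 1)) = 1 + (Γ.a 1 + 1) / q) :
    Γ.distMat (ind 1) * Γ.distMat (fun j => q⁻¹ ^ j - μ) =
      (Γ.b 1 / q - 1) • Γ.distMat (fun j => q⁻¹ ^ j - μ) := by
  have h1 : Γ.distMat (fun j => q⁻¹ ^ j - μ) =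
      Γ.distMat (fun j => q⁻¹ ^ j) - μ • Γ.distMat (fun _ => 1) := by
    ext x y
    simp
  rw [h1, mul_sub, mul_smul_comm, h.adj_mul_inv_pow hq0 hq1 hd, adj_mul_one, ← hμ]
  module

/-- The matrix `K_{1/q} - μ J` is a positive multiple of an idempotent. -/
lemma exists_sub_mul_sub {μ : ℝ} (hq0 : q ≠ 0) (hq1 : q ≠ 1) (hd : 3 ≤ Γ.d)
    (hμ : μ * (Γ.b 0 - (Γ.b 1 / q - 1)) = 1 + (Γ.a 1 + 1) / q) (hμ1 : μ < 1) :
    ∃ c : ℝ, 0 < c ∧ Γ.distMat (fun j => q⁻¹ ^ j - μ) * Γ.distMat (fun j => q⁻¹ ^ j - μ) =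
      c • Γ.distMat (fun j => q⁻¹ ^ j - μ) := by
  obtain ⟨c, hc⟩ := Γ.exists_distMat_mul (h.adj_mul_sub hq0 hq1 hd hμ) fun j => q⁻¹ ^ j - μ
  refine ⟨c, ?_, hc⟩
  obtain ⟨x⟩ := Γ.conn.nonempty
  have h1 := congrFun (congrFun hc x) x
  simp only [Matrix.mul_apply, Matrix.smul_apply, distMat_apply, SimpleGraph.dist_self, pow_zero,
    smul_eq_mul] at h1
  have h2 : 0 < ∑ y, (q⁻¹ ^ Γ.G.dist x y - μ) * (q⁻¹ ^ Γ.G.dist y x - μ) := by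
    refine Finset.sum_pos' (fun y _ => ?_) ⟨x, Finset.mem_univ _, ?_⟩
    · rw [Γ.G.dist_comm (u := y)]
      exact mul_self_nonneg _
    · have : 0 < 1 - μ := by linarith
      simpa using mul_pos this this
  rw [h1] at h2
  exact pos_of_mul_pos_left h2 (by linarith)

lemma posSemidef_sub {μ : ℝ} (hq0 : q ≠ 0) (hq1 : q ≠ 1) (hd : 3 ≤ Γ.d)
    (hμ : μ * (Γ.b 0 - (Γ.b 1 / q - 1)) = 1 + (Γ.a 1 + 1) / q) (hμ1 : μ < 1) :
    (Γ.distMat fun j => q⁻¹ ^ j - μ).PosSemidef := by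
  obtain ⟨c, hc, hcM⟩ := h.exists_sub_mul_sub hq0 hq1 hd hμ hμ1
  exact Matrix.posSemidef_of_mul_self_eq_smul (Γ.distMat_isSymm _) hc hcM

lemma exists_sum_quadMat_eq {μ : ℝ} (hq0 : q ≠ 0) (hq1 : q ≠ 1) (hd : 3 ≤ Γ.d)
    (hμ : μ * (Γ.b 0 - (Γ.b 1 / q - 1)) = 1 + (Γ.a 1 + 1) / q) (hμ1 : μ < 1) (x y : Γ.X) :
    ∃ C : ℝ, ∀ z, ∑ v, Γ.quadMat (Γ.b 1 / q - 1) (Γ.b 2 / q ^ 2 - (1 + q)) z v *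
      (q⁻¹ ^ Γ.G.dist x v * q⁻¹ ^ Γ.G.dist y v) = C := by
  obtain ⟨c, -, hcM⟩ := h.exists_sub_mul_sub hq0 hq1 hd hμ hμ1
  obtain ⟨κ, l, hS⟩ := h.adj_mul_inv_sq_pow hq0 hq1 hd
  have hK := h.adj_mul_inv_pow hq0 hq1 hd
  have hJ := Γ.adj_mul_one
  set k : ℝ := (Γ.b 0 : ℝ)
  set θ₁ : ℝ := Γ.b 1 / q - 1
  set θ₂ : ℝ := Γ.b 2 / q ^ 2 - (1 + q)
  set L : ℝ := 1 + (Γ.a 1 + 1) / q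
  set A := Γ.distMat (ind 1)
  set K := Γ.distMat (fun j => q⁻¹ ^ j) with hKdef
  set S := Γ.distMat (fun j => q⁻¹ ^ j * q⁻¹ ^ j) with hSdef
  set J := Γ.distMat (fun _ => 1) with hJdef
  set M := Γ.distMat (fun j => q⁻¹ ^ j - μ) with hMdef
  set R := Γ.quadMat θ₁ θ₂
  have hRJ : R * J = ((k - θ₁) * (k - θ₂)) • J := by
    rw [Γ.quadMat_mul, hJ, mul_smul_comm, hJ]
    module
  have hRK : R * K = (L * (k - θ₂)) • J := by
    rw [Γ.quadMat_mul, hK, mul_add, mul_smul_comm, mul_smul_comm, hK, hJ]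
    module
  have hRS : R * S = (κ * L + l * (k - θ₁)) • J := by
    rw [Γ.quadMat_mul, hS, mul_add, mul_add, mul_smul_comm, mul_smul_comm, mul_smul_comm, hS, hK,
      hJ]
    module
  have hRJ' : ∀ w, ∑ v, R w v = (k - θ₁) * (k - θ₂) := fun w => by
    simpa [Matrix.mul_apply, hJdef] using congrFun (congrFun hRJ w) w
  have hRK' : ∀ w x, ∑ v, R w v * q⁻¹ ^ Γ.G.dist x v = L * (k - θ₂) := fun w x => by
    simpa [Matrix.mul_apply, hKdef, hJdef, Γ.G.dist_comm (v := x)] using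
      congrFun (congrFun hRK w) x
  have hRS' : ∀ w x, ∑ v, R w v * (q⁻¹ ^ Γ.G.dist x v * q⁻¹ ^ Γ.G.dist x v) =
      κ * L + l * (k - θ₁) := fun w x => by
    simpa [Matrix.mul_apply, hSdef, hJdef, Γ.G.dist_comm (v := x)] using
      congrFun (congrFun hRS w) x
  have : Nonempty Γ.X := Γ.conn.nonempty
  have key := Matrix.sum_mul_mul_eq_const (M := M) (R := R) (m := 1 - μ)
    (ω := κ * L + l * (k - θ₁) - 2 * μ * (L * (k - θ₂)) + μ ^ 2 * ((k - θ₁) * (k - θ₂)))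
    (Γ.distMat_isSymm _) hcM (by simp [hMdef]) hRJ' ?_ x y
  · refine ⟨(k - θ₁) * (k - θ₂) * c / Fintype.card Γ.X * M x y + 2 * μ * (L * (k - θ₂)) -
      μ ^ 2 * ((k - θ₁) * (k - θ₂)), fun z => ?_⟩
    have hsum : ∑ v, R z v * (q⁻¹ ^ Γ.G.dist x v * q⁻¹ ^ Γ.G.dist y v) =
        ∑ v, R z v * (M x v * M y v) + μ * ∑ v, R z v * q⁻¹ ^ Γ.G.dist x v +
          μ * ∑ v, R z v * q⁻¹ ^ Γ.G.dist y v - μ ^ 2 * ∑ v, R z v := by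
      rw [Finset.mul_sum, Finset.mul_sum, Finset.mul_sum, ← Finset.sum_add_distrib,
        ← Finset.sum_add_distrib, ← Finset.sum_sub_distrib]
      refine Finset.sum_congr rfl fun v _ => ?_
      simp only [hMdef, distMat_apply]
      ring
    rw [hsum, key z, hRK' z x, hRK' z y, hRJ' z]
    ring
  · intro w x
    rw [← hRS' w x, ← hRK' w x, ← hRJ' w, Finset.mul_sum, Finset.mul_sum,
      ← Finset.sum_sub_distrib, ← Finset.sum_add_distrib]
    refine Finset.sum_congr rfl fun v _ => ?_
    simp only [hMdef, distMat_apply, Γ.G.dist_comm (v := x)]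
    ring

end HasClassical

end DRG

namespace DRG

lemma ind_one_mul_sub_mul_sub (t : ℝ) {X Y Z : ℕ} (hXZ : X ≤ Z + 1) (hYZ : Y ≤ Z + 1)
    (hX : X = 0 → Y = 1 ∧ Z = 1) (hY : Y = 0 → X = 1 ∧ Z = 1) :
    ind 1 Z * ((t ^ X - t) * (t ^ Y - t)) =
      t ^ 2 * (1 - t) ^ 2 * (ind 1 Z * (ind 2 X * ind 2 Y)) := by
  by_cases h : Z = 1
  · subst h
    interval_cases X <;> interval_cases Y <;> simp_all [ind]
    ring
  · simp [ind, h]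

lemma ind_two_mul_sub_mul_sub (t : ℝ) {X Y Z : ℕ} (hXZ : X ≤ Z + 1) (hYZ : Y ≤ Z + 1)
    (hZX : Z ≤ X + 1) (hZY : Z ≤ Y + 1) (hXY : X ≤ Y + 1) (hYX : Y ≤ X + 1) :
    ind 2 Z * ((t ^ X - t ^ 2) * (t ^ Y - t ^ 2)) =
      t ^ 2 * (1 - t) ^ 2 * (ind 1 X * ind 1 Y * ind 2 Z) +
        t ^ 4 * (1 - t) ^ 2 * (ind 2 Z * (ind 3 X * ind 3 Y)) := by
  by_cases h : Z = 2
  · subst h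
    have h1 : 1 ≤ X := by omega
    have h2 : 1 ≤ Y := by omega
    interval_cases X <;> interval_cases Y <;> simp_all [ind] <;> ring
  · simp [ind, h]

lemma ind_mul_add_ind_mul {X Y Z : ℕ} (hXZ : X ≤ Z + 1) (hYZ : Y ≤ Z + 1)
    (hZX : Z ≤ X + 1) (hZY : Z ≤ Y + 1) (hXY : X ≤ Y + 1) (hYX : Y ≤ X + 1)
    (hX : X = 0 → Y = 1 ∧ Z = 1) (hY : Y = 0 → X = 1 ∧ Z = 1) (hZ : Z = 0 → X = 1 ∧ Y = 1) :
    ind 1 Z * (ind 2 X * ind 2 Y) + ind 1 X * ind 1 Y * ind 2 Z =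
      ind 1 Z * ind 2 X - ind 1 Z * ind 1 Y + ind 0 X + ind 1 X * ind 1 Y - ind 0 Z := by
  by_cases h : Z ≤ 2
  · interval_cases Z <;> interval_cases X <;> interval_cases Y <;> simp_all [ind]
  · have h1 : X ≠ 0 ∧ X ≠ 1 ∧ Z ≠ 0 ∧ Z ≠ 1 ∧ Z ≠ 2 := by omega
    simp [ind, h1]

variable (Γ : DRG)

lemma sum_ind_zero_mul (f : ℕ → ℝ) (x y : Γ.X) :
    ∑ z, ind 0 (Γ.G.dist y z) * f (Γ.G.dist x z) = f (Γ.G.dist x y) := by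
  have h1 := congrFun (congrFun (one_mul (Γ.distMat f)) y) x
  rw [← distMat_ind_zero] at h1
  simpa [Matrix.mul_apply, Γ.G.dist_comm (v := x)] using h1

lemma sum_ind_two_mul (f : ℕ → ℝ) (x y : Γ.X) :
    Γ.c 2 * ∑ z, ind 2 (Γ.G.dist y z) * f (Γ.G.dist x z) =
      Γ.step (Γ.step f) (Γ.G.dist x y) - Γ.a 1 * Γ.step f (Γ.G.dist x y) -
        Γ.b 0 * f (Γ.G.dist x y) := by
  have h1 := congrFun (congrFun (Γ.quadMat_mul 0 0 (Γ.distMat f)) y) x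
  simp only [adj_mul_distMat, Matrix.mul_apply, Matrix.add_apply, Matrix.sub_apply, quadMat,
    Matrix.smul_apply, distMat_apply, Γ.G.dist_comm (v := x), smul_eq_mul, mul_zero, add_zero,
    zero_mul, sub_zero, add_mul, mul_assoc, Finset.sum_add_distrib, ← Finset.mul_sum,
    sum_ind_one_mul, sum_ind_zero_mul] at h1
  linarith

namespace HasClassical

variable {Γ} {q α β : ℝ} (h : Γ.HasClassical q α β)
include h

lemma step_step_inv_pow_one (hq0 : q ≠ 0) (hq1 : q ≠ 1) (hd : 3 ≤ Γ.d) :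
    Γ.step (Γ.step fun j => q⁻¹ ^ j) 1 =
      (Γ.b 1 / q - 1) * ((Γ.b 1 / q - 1) * q⁻¹ + (1 + (Γ.a 1 + 1) / q)) +
        Γ.b 0 * (1 + (Γ.a 1 + 1) / q) := by
  have h1 := h.step_inv_pow hq0 hq1 hd (i := 1) (by omega)
  have h2 := Γ.c_add_a_add_b (i := 1) (by omega)
  rw [step, h.step_inv_pow hq0 hq1 hd (i := 1 - 1) (by omega), h1,
    h.step_inv_pow hq0 hq1 hd (i := 1 + 1) (by omega), ← h2]
  simp only [step] at h1
  rw [pow_one] at h1 ⊢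
  linear_combination (Γ.b 1 / q - 1) * h1

/-- A relation between the numbers of vertices in two kinds of position with respect to a
triangle. -/
lemma sum_triangle (hq0 : q ≠ 0) (hq1 : q ≠ 1) (hd : 3 ≤ Γ.d) {μ : ℝ}
    (hμ : μ * (Γ.b 0 - (Γ.b 1 / q - 1)) = 1 + (Γ.a 1 + 1) / q) (hμ1 : μ < 1)
    {x y z : Γ.X} (hxy : Γ.G.dist x y = 1) (hxz : Γ.G.dist x z = 1) (hyz : Γ.G.dist y z = 1) :
    Γ.c 2 * (∑ w, ind 2 (Γ.G.dist z w) * ind 3 (Γ.G.dist x w) -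
        ∑ w, ind 2 (Γ.G.dist z w) * (ind 3 (Γ.G.dist x w) * ind 3 (Γ.G.dist y w))) =
      (1 + q) * Γ.b 2 *
        ∑ w, ind 1 (Γ.G.dist x w) * ind 1 (Γ.G.dist y w) * ind 2 (Γ.G.dist z w) := by
  obtain ⟨C, hC⟩ := h.exists_sum_quadMat_eq hq0 hq1 hd hμ hμ1 x y
  have htri : ∀ {u v : Γ.X}, Γ.G.dist u v = 1 → ∀ w,
      Γ.G.dist u w ≤ Γ.G.dist v w + 1 ∧ Γ.G.dist v w ≤ Γ.G.dist u w + 1 := fun {u v} huv w => by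
    rw [Γ.G.dist_comm (u := u), Γ.G.dist_comm (u := v)]
    have hadj := SimpleGraph.dist_eq_one_iff_adj.1 huv
    exact ⟨Γ.dist_le_succ_of_adj hadj.symm, Γ.dist_le_succ_of_adj hadj⟩
  have hzero : ∀ {u w : Γ.X}, Γ.G.dist u w = 0 → u = w := fun {u w} h0 =>
    (Γ.conn.dist_eq_zero_iff).1 h0
  have hyx : Γ.G.dist y x = 1 := by rw [Γ.G.dist_comm, hxy]
  have hzx : Γ.G.dist z x = 1 := by rw [Γ.G.dist_comm, hxz]
  have hzy : Γ.G.dist z y = 1 := by rw [Γ.G.dist_comm, hyz]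
  have hX : ∀ w, Γ.G.dist x w = 0 → Γ.G.dist y w = 1 ∧ Γ.G.dist z w = 1 := fun w h0 => by
    rw [← hzero h0]; exact ⟨hyx, hzx⟩
  have hY : ∀ w, Γ.G.dist y w = 0 → Γ.G.dist x w = 1 ∧ Γ.G.dist z w = 1 := fun w h0 => by
    rw [← hzero h0]; exact ⟨hxy, hzy⟩
  have hZ : ∀ w, Γ.G.dist z w = 0 → Γ.G.dist x w = 1 ∧ Γ.G.dist y w = 1 := fun w h0 => by
    rw [← hzero h0]; exact ⟨hxz, hyz⟩
  set t := q⁻¹ with ht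
  set K := ∑ w, ind 1 (Γ.G.dist x w) * ind 1 (Γ.G.dist y w) * ind 2 (Γ.G.dist z w) with hK
  set N := ∑ w, ind 2 (Γ.G.dist z w) * (ind 3 (Γ.G.dist x w) * ind 3 (Γ.G.dist y w)) with hN
  set m := ∑ w, ind 1 (Γ.G.dist z w) * (ind 2 (Γ.G.dist x w) * ind 2 (Γ.G.dist y w)) with hm
  have hP : Γ.c 2 * ∑ w, ind 2 (Γ.G.dist z w) * ind 3 (Γ.G.dist x w) = (Γ.b 1 : ℝ) * Γ.b 2 := by
    rw [sum_ind_two_mul, hxz]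
    simp [step, ind]
  have hmK : m + K = Γ.b 1 := by
    have hone : ∀ u : Γ.X, ∑ w, ind 0 (Γ.G.dist u w) = 1 := fun u => by
      simpa using Γ.sum_ind_zero_mul (fun _ => 1) u u
    rw [hm, hK, ← Finset.sum_add_distrib, Finset.sum_congr rfl fun w _ => ind_mul_add_ind_mul
      (htri hxz w).1 (htri hyz w).1 (htri hxz w).2 (htri hyz w).2 (htri hxy w).1 (htri hxy w).2
      (hX w) (hY w) (hZ w)]
    simp only [Finset.sum_add_distrib, Finset.sum_sub_distrib, hone, sum_ind_one_mul, hxz, hyz,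
      hyx]
    simp [step, ind]
    ring
  have hs1 := h.step_inv_pow hq0 hq1 hd (i := 1) (by omega)
  rw [← ht, pow_one] at hs1
  have hs2 := h.step_step_inv_pow_one hq0 hq1 hd
  rw [← ht] at hs2
  have hone : Γ.step (fun _ => 1) 1 = Γ.b 0 := Γ.step_one (by omega)
  have hone' : Γ.step (Γ.step fun _ => 1) 1 = Γ.b 0 * Γ.b 0 := by
    rw [step, Γ.step_one (by omega), Γ.step_one (by omega), Γ.step_one (by omega),
      ← Γ.c_add_a_add_b (i := 1) (by omega)]
    ring
  have hsum1 : ∑ w, ind 1 (Γ.G.dist z w) * (t ^ Γ.G.dist x w * t ^ Γ.G.dist y w) =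
      2 * t * Γ.step (fun j => t ^ j) 1 - t ^ 2 * Γ.b 0 + t ^ 2 * (1 - t) ^ 2 * m := by
    have h1 := Γ.sum_ind_one_mul (fun j => t ^ j) x z
    have h2 := Γ.sum_ind_one_mul (fun j => t ^ j) y z
    have h3 := Γ.sum_ind_one_mul (fun j => 1) y z
    rw [hxz] at h1
    rw [hyz] at h2 h3
    rw [hone] at h3
    calc _ = t * ∑ w, ind 1 (Γ.G.dist z w) * t ^ Γ.G.dist x w +
          t * ∑ w, ind 1 (Γ.G.dist z w) * t ^ Γ.G.dist y w -
          t ^ 2 * ∑ w, ind 1 (Γ.G.dist z w) * 1 + t ^ 2 * (1 - t) ^ 2 * m := by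
          rw [hm]
          simp only [Finset.mul_sum, ← Finset.sum_add_distrib, ← Finset.sum_sub_distrib]
          refine Finset.sum_congr rfl fun w _ => ?_
          rw [← ind_one_mul_sub_mul_sub t (htri hxz w).1 (htri hyz w).1 (hX w) (hY w)]
          ring
      _ = _ := by
          rw [h1, h2, h3]
          ring
  have hsum2 : Γ.c 2 * ∑ w, ind 2 (Γ.G.dist z w) * (t ^ Γ.G.dist x w * t ^ Γ.G.dist y w) =
      2 * t ^ 2 * (Γ.step (Γ.step fun j => t ^ j) 1 - Γ.a 1 * Γ.step (fun j => t ^ j) 1 -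
        Γ.b 0 * t) - t ^ 4 * (Γ.b 0 * Γ.b 0 - Γ.a 1 * Γ.b 0 - Γ.b 0) +
        Γ.c 2 * (t ^ 2 * (1 - t) ^ 2 * K + t ^ 4 * (1 - t) ^ 2 * N) := by
    have h1 := Γ.sum_ind_two_mul (fun j => t ^ j) x z
    have h2 := Γ.sum_ind_two_mul (fun j => t ^ j) y z
    have h3 := Γ.sum_ind_two_mul (fun j => 1) y z
    rw [hxz, pow_one] at h1
    rw [hyz, pow_one] at h2
    rw [hyz, hone, hone', mul_one] at h3
    calc _ = t ^ 2 * (Γ.c 2 * ∑ w, ind 2 (Γ.G.dist z w) * t ^ Γ.G.dist x w) +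
          t ^ 2 * (Γ.c 2 * ∑ w, ind 2 (Γ.G.dist z w) * t ^ Γ.G.dist y w) -
          t ^ 4 * (Γ.c 2 * ∑ w, ind 2 (Γ.G.dist z w) * 1) +
          Γ.c 2 * (t ^ 2 * (1 - t) ^ 2 * K + t ^ 4 * (1 - t) ^ 2 * N) := by
          rw [hK, hN]
          simp only [Finset.mul_sum, ← Finset.sum_add_distrib, ← Finset.sum_sub_distrib]
          refine Finset.sum_congr rfl fun w _ => ?_
          rw [← ind_two_mul_sub_mul_sub t (htri hxz w).1 (htri hyz w).1 (htri hxz w).2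
            (htri hyz w).2 (htri hxy w).1 (htri hxy w).2]
          ring
      _ = _ := by
          rw [h1, h2, h3]
          ring
  have hsum0 : ∑ w, ind 0 (Γ.G.dist z w) * (t ^ Γ.G.dist x w * t ^ Γ.G.dist y w) = t ^ 2 := by
    have h1 := Γ.sum_ind_zero_mul (fun j => t ^ 2) z z
    rw [← h1]
    refine Finset.sum_congr rfl fun w _ => ?_
    by_cases h0 : Γ.G.dist z w = 0
    · rw [(hZ w h0).1, (hZ w h0).2]
      ring
    · simp [ind, h0]
  have hsumx : ∀ j, ∑ w, ind j (Γ.G.dist x w) * (t ^ Γ.G.dist x w * t ^ Γ.G.dist y w) =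
      t ^ j * ∑ w, ind j (Γ.G.dist x w) * t ^ Γ.G.dist y w := fun j => by
    rw [Finset.mul_sum]
    refine Finset.sum_congr rfl fun w _ => ?_
    by_cases h0 : Γ.G.dist x w = j
    · rw [h0]
      ring
    · simp [ind, h0]
  have hx2 := Γ.sum_ind_two_mul (fun j => t ^ j) y x
  have hx1 := Γ.sum_ind_one_mul (fun j => t ^ j) y x
  have hx0 := Γ.sum_ind_zero_mul (fun j => t ^ j) y x
  rw [hyx, pow_one] at hx2 hx0
  rw [hyx] at hx1
  have hCx := hC x
  rw [← hC z] at hCx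
  simp only [quadMat, distMat_apply, add_mul, mul_assoc, Finset.sum_add_distrib,
    ← Finset.mul_sum] at hCx
  rw [hsumx, hsumx, hsumx, hsum0, hsum1, hsum2, hx1, hx0, mul_left_comm, hx2, hs2, hs1,
    eq_sub_of_add_eq hmK] at hCx
  have hcoef : (t ^ 4 * (1 - t) ^ 2) ≠ 0 := by
    refine mul_ne_zero (pow_ne_zero _ (inv_ne_zero hq0)) (pow_ne_zero _ (sub_ne_zero.2 ?_))
    rw [ht, ne_comm, inv_ne_one]
    exact hq1
  refine mul_left_cancel₀ hcoef ?_
  rw [mul_sub, hP]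
  clear_value t K N
  subst ht
  linear_combination (norm := skip) hCx
  rw [h.a_one hd, h.c_two hd, h.b_one hd, h.b_two hd, h.b_zero]
  generalize gaussOne q Γ.d = D
  field_simp
  ring

end HasClassical

end DRG

lemma Matrix.PosSemidef.sum_sum_nonneg {X : Type*} [Fintype X] {M : Matrix X X ℝ}
    (hM : M.PosSemidef) (C : Finset X) : 0 ≤ ∑ i ∈ C, ∑ j ∈ C, M i j := by
  classical
  have h1 := hM.dotProduct_mulVec_nonneg fun i => if i ∈ C then 1 else 0
  simpa [dotProduct, mulVec] using h1

namespace DRG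

lemma ind_nonneg (j i : ℕ) : 0 ≤ ind j i := by
  unfold ind
  split_ifs <;> simp

lemma ind_le_one (j i : ℕ) : ind j i ≤ 1 := by
  unfold ind
  split_ifs <;> simp

variable (Γ : DRG)

lemma posSemidef_distMat_one : (Γ.distMat fun _ => 1).PosSemidef := by
  have h1 := Matrix.posSemidef_vecMulVec_self_star (fun _ : Γ.X => (1 : ℝ))
  convert h1 using 1
  ext x y
  simp [Matrix.vecMulVec_apply]

/-- If no two common neighbours of adjacent vertices are at distance two, then every edge lies in a
clique of size `a₁ + 2`. -/
lemma exists_clique (hd : 3 ≤ Γ.d)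
    (hΓ : ∀ x y z w : Γ.X, Γ.G.dist x y = 1 → Γ.G.dist x z = 1 → Γ.G.dist y z = 1 →
      Γ.G.dist x w = 1 → Γ.G.dist y w = 1 → Γ.G.dist z w ≠ 2) :
    ∃ C : Finset Γ.X, C.card = Γ.a 1 + 2 ∧ ∀ z ∈ C, ∀ w ∈ C, z ≠ w → Γ.G.dist z w = 1 := by
  obtain ⟨x, y, hxy⟩ := Γ.exists_dist_eq (i := 1) (by omega)
  have hyx : Γ.G.dist y x = 1 := by rw [Γ.G.dist_comm, hxy]
  set T : Finset Γ.X := Finset.univ.filter fun w => Γ.G.dist x w = 1 ∧ Γ.G.dist y w = 1 with hT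
  have hmem : ∀ w, w ∈ T ↔ Γ.G.dist x w = 1 ∧ Γ.G.dist y w = 1 := fun w => by simp [hT]
  have hcard : T.card = Γ.a 1 := by
    rw [← Γ.count_a 1 (by omega) x y hxy, ← Set.ncard_coe_finset]
    congr 1
    ext w
    simp [hT, ← SimpleGraph.dist_eq_one_iff_adj, and_comm]
  have hyT : y ∉ T := fun hy => by simpa using ((hmem y).1 hy).2
  have hxT : x ∉ insert y T := fun hx => by
    rcases Finset.mem_insert.1 hx with rfl | hx
    · simp at hxy
    · simpa using ((hmem x).1 hx).1
  refine ⟨insert x (insert y T), by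
    rw [Finset.card_insert_of_notMem hxT, Finset.card_insert_of_notMem hyT, hcard], ?_⟩
  intro z hz w hw hzw
  simp only [Finset.mem_insert, hmem] at hz hw
  rcases hz with rfl | rfl | ⟨hz1, hz2⟩ <;> rcases hw with rfl | rfl | ⟨hw1, hw2⟩ <;>
    first
      | exact absurd rfl hzw
      | assumption
      | (rw [Γ.G.dist_comm]; assumption)
      | skip
  have h0 : Γ.G.dist z w ≠ 0 := fun h0 => hzw (Γ.conn.dist_eq_zero_iff.1 h0)
  have h2 := hΓ x y z w hxy hz1 hz2 hw1 hw2
  have h3 := Γ.dist_le_succ_of_adj (x := z) (SimpleGraph.dist_eq_one_iff_adj.1 hw1)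
  rw [Γ.G.dist_comm (u := z) (v := x), hz1] at h3
  omega

namespace HasClassical

variable {Γ} {q α β : ℝ} (h : Γ.HasClassical q α β)
include h

lemma dist_ne_two (hq : q ≤ -2) (hd : 3 ≤ Γ.d) {μ : ℝ}
    (hμ : μ * (Γ.b 0 - (Γ.b 1 / q - 1)) = 1 + (Γ.a 1 + 1) / q) (hμ1 : μ < 1)
    (x y z w : Γ.X) (hxy : Γ.G.dist x y = 1) (hxz : Γ.G.dist x z = 1) (hyz : Γ.G.dist y z = 1)
    (hxw : Γ.G.dist x w = 1) (hyw : Γ.G.dist y w = 1) : Γ.G.dist z w ≠ 2 := by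
  intro hzw
  have h1 := h.sum_triangle (by linarith) (by linarith) hd hμ hμ1 hxy hxz hyz
  have h2 : ∑ w, ind 2 (Γ.G.dist z w) * (ind 3 (Γ.G.dist x w) * ind 3 (Γ.G.dist y w)) ≤
      ∑ w, ind 2 (Γ.G.dist z w) * ind 3 (Γ.G.dist x w) := by
    refine Finset.sum_le_sum fun w _ => mul_le_mul_of_nonneg_left ?_ (ind_nonneg _ _)
    exact mul_le_of_le_one_right (ind_nonneg _ _) (ind_le_one _ _)
  have h3 : 1 ≤ ∑ w, ind 1 (Γ.G.dist x w) * ind 1 (Γ.G.dist y w) * ind 2 (Γ.G.dist z w) := by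
    have h4 := Finset.single_le_sum (f := fun w =>
      ind 1 (Γ.G.dist x w) * ind 1 (Γ.G.dist y w) * ind 2 (Γ.G.dist z w))
      (fun w _ => mul_nonneg (mul_nonneg (ind_nonneg _ _) (ind_nonneg _ _)) (ind_nonneg _ _))
      (Finset.mem_univ w)
    simpa [ind, hxw, hyw, hzw] using h4
  have hb : (0 : ℝ) < Γ.b 2 := by exact_mod_cast Γ.b_pos (i := 2) (by omega)
  have h5 := mul_nonneg (Nat.cast_nonneg (α := ℝ) (Γ.c 2)) (sub_nonneg.2 h2)
  rw [h1] at h5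
  have h6 : (1 + q) * Γ.b 2 < 0 := mul_neg_of_neg_of_pos (by linarith) hb
  exact absurd h5 (not_le.2 (mul_neg_of_neg_of_pos h6 (by linarith)))

/-- The matrix `K_{1/q}` is positive semidefinite. -/
lemma posSemidef_inv (hq : 2 ≤ |q|) (hd : 3 ≤ Γ.d) :
    (Γ.distMat fun j => q⁻¹ ^ j).PosSemidef := by
  have hq0 : q ≠ 0 := by
    rintro rfl
    norm_num at hq
  have hq1 : q ≠ 1 := by
    rintro rfl
    norm_num at hq
  have hb1 : (0 : ℝ) < Γ.b 1 := by exact_mod_cast Γ.b_pos (i := 1) (by omega)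
  have ha1 : (0 : ℝ) ≤ Γ.a 1 := Nat.cast_nonneg _
  have hk : (Γ.b 0 : ℝ) = Γ.a 1 + 1 + Γ.b 1 := by linarith [h.a_one hd]
  have hdiv : ∀ r : ℝ, 0 < r → r / q < r := fun r hr => by
    refine (le_abs_self _).trans_lt ?_
    rw [abs_div, abs_of_pos hr, div_lt_iff₀ (by linarith)]
    nlinarith
  have hg : 0 < Γ.b 0 - (Γ.b 1 / q - 1) := by linarith [hdiv _ hb1]
  set μ := (1 + (Γ.a 1 + 1) / q) / (Γ.b 0 - (Γ.b 1 / q - 1)) with hμdef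
  have hμ : μ * (Γ.b 0 - (Γ.b 1 / q - 1)) = 1 + (Γ.a 1 + 1) / q := div_mul_cancel₀ _ hg.ne'
  have hμ1 : μ < 1 := by
    rw [hμdef, div_lt_one hg]
    linarith [hdiv _ hb1, hdiv (Γ.a 1 + 1) (by linarith)]
  have hM := h.posSemidef_sub hq0 hq1 hd hμ hμ1
  have hμ0 : 0 ≤ μ := by
    rcases le_abs.1 hq with hq | hq
    · rw [hμdef]
      have : 0 < q := by linarith
      positivity
    · obtain ⟨C, hC, hCd⟩ := Γ.exists_clique hd (h.dist_ne_two (by linarith) hd hμ hμ1)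
      have hsum : ∑ z ∈ C, ∑ w ∈ C, Γ.distMat (fun j => q⁻¹ ^ j - μ) z w =
          (Γ.a 1 + 2) * (1 - μ + (Γ.a 1 + 1) * (q⁻¹ - μ)) := by
        have hrow : ∀ z ∈ C, ∑ w ∈ C, Γ.distMat (fun j => q⁻¹ ^ j - μ) z w =
            1 - μ + (Γ.a 1 + 1) * (q⁻¹ - μ) := fun z hz => by
          rw [← Finset.add_sum_erase _ _ hz, Finset.sum_congr rfl (g := fun _ => q⁻¹ - μ),
            Finset.sum_const, Finset.card_erase_of_mem hz, hC]
          · simp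
          · intro w hw
            rw [distMat_apply, hCd z hz w (Finset.mem_of_mem_erase hw)
              (Finset.ne_of_mem_erase hw).symm, pow_one]
        rw [Finset.sum_congr rfl hrow, Finset.sum_const, hC]
        simp [mul_add]
      have h1 := hM.sum_sum_nonneg C
      rw [hsum] at h1
      have h3 : 0 ≤ 1 - μ + (Γ.a 1 + 1) * (q⁻¹ - μ) :=
        nonneg_of_mul_nonneg_right h1 (by linarith)
      by_contra! hneg
      have h4 : Γ.b 1 / q < 0 := div_neg_of_pos_of_neg hb1 (by linarith)
      have h5 : (Γ.a 1 + 1) / q = (Γ.a 1 + 1) * q⁻¹ := div_eq_mul_inv _ _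
      nlinarith
  have hK : (Γ.distMat fun j => q⁻¹ ^ j) =
      (Γ.distMat fun j => q⁻¹ ^ j - μ) + μ • Γ.distMat fun _ => 1 := by
    ext x y
    simp
  rw [hK]
  exact hM.add (Γ.posSemidef_distMat_one.smul hμ0)

end HasClassical

end DRG

/-- If `Γ` has classical parameters `(d, q, α, β)` with `d ≥ 3` and `q ∈ ℤ`, `|q| ≥ 2`,
then `q^{-i} ∈ π(Γ)` for every `i ≥ 0`. -/
theorem stmt13 (Γ : DRG) (q : ℤ) (α β : ℝ) (hd : 3 ≤ Γ.d) (hq : 2 ≤ |q|)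
    (hcp : Γ.HasClassical (q : ℝ) α β) (i : ℕ) :
    Γ.piMem (((q : ℝ) ^ i)⁻¹) := by
  have hq' : 2 ≤ |(q : ℝ)| := by exact_mod_cast hq
  unfold DRG.piMem
  induction i with
  | zero =>
    have h1 : Γ.Kmat (((q : ℝ) ^ 0)⁻¹) = Γ.distMat fun _ => 1 := by
      ext x y
      simp [DRG.Kmat]
    rw [h1]
    exact Γ.posSemidef_distMat_one
  | succ i ih =>
    have h1 : Γ.Kmat (((q : ℝ) ^ (i + 1))⁻¹) =
        Γ.Kmat (((q : ℝ) ^ i)⁻¹) ⊙ Γ.distMat fun j => (q : ℝ)⁻¹ ^ j := by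
      ext x y
      simp only [DRG.Kmat, Matrix.of_apply, Matrix.hadamard_apply, DRG.distMat_apply, ← mul_pow,
        pow_succ, mul_inv]
    rw [h1]
    exact ih.hadamard (hcp.posSemidef_inv hq' hd)
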